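/- arXiv:math/0503335 — 8 statements merged into one kernel-verified Lean document; each statement's English description precedes it below -/
import Mathlib

section
/- For every n ≥ 2 and every m with 0 ≤ m < n! − 1, the vectors (d_1(m),…,d_{n−1}(m)) and (d_1(m+1),…,d_{n−1}(m+1)) differ in exactly one coordinate k, and at that coordinate |d_k(m+1) − d_k(m)| = 1. -/
/-- The parity flag `f_k(m) = ⌊m/(k+1)!⌋ mod 2`. -/
def serialFlag (k m : ℕ) : ℕ := m / Nat.factorial (k + 1) % 2

/-- `d_k(m) = ⌊m/k!⌋ mod (k+1)` if `f_k(m) = 0`, and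
`d_k(m) = k − (⌊m/k!⌋ mod (k+1))` if `f_k(m) = 1`. -/
def serialDigit (k m : ℕ) : ℕ :=
  if serialFlag k m = 0 then m / Nat.factorial k % (k + 1)
  else k - m / Nat.factorial k % (k + 1)

theorem serialDigit_eq (k m : ℕ) : serialDigit k m =
    if m / Nat.factorial k / (k + 1) % 2 = 0 then m / Nat.factorial k % (k + 1)
    else k - m / Nat.factorial k % (k + 1) := by
  unfold serialDigit serialFlag
  rw [Nat.factorial_succ, mul_comm (k + 1), Nat.div_div_eq_div_mul]

theorem digit_same_of_not_dvd (k m : ℕ) (h : ¬ Nat.factorial k ∣ m + 1) :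
    serialDigit k m = serialDigit k (m + 1) := by
  rw [serialDigit_eq, serialDigit_eq, Nat.succ_div_of_not_dvd h]

theorem digit_same_of_dvd (k m : ℕ) (h : Nat.factorial (k + 1) ∣ m + 1) :
    serialDigit k m = serialDigit k (m + 1) := by
  have h1 : Nat.factorial k ∣ m + 1 := (Nat.factorial_dvd_factorial (Nat.le_succ k)).trans h
  rw [serialDigit_eq, serialDigit_eq, Nat.succ_div_of_dvd h1]
  have h2 : (k + 1) ∣ m / Nat.factorial k + 1 := by
    rw [← Nat.succ_div_of_dvd h1]
    apply Nat.dvd_div_of_mul_dvd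
    rwa [mul_comm, ← Nat.factorial_succ]
  generalize m / Nat.factorial k = q at h2
  have h3 : (q + 1) % (k + 1) = 0 := Nat.mod_eq_zero_of_dvd h2
  have h4 : q % (k + 1) = k := by
    obtain ⟨c, hc⟩ := h2
    cases c with
    | zero => omega
    | succ c =>
      have : q = k + (k + 1) * c := by
        have : (k + 1) * (c + 1) = (k + 1) * c + (k + 1) := by ring
        omega
      rw [this, Nat.add_mul_mod_self_left, Nat.mod_eq_of_lt (Nat.lt_succ_self k)]
  rw [Nat.succ_div_of_dvd h2, h3, h4]
  split_ifs <;> omega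

theorem digit_step (k m : ℕ) (h1 : Nat.factorial k ∣ m + 1)
    (h : ¬ Nat.factorial (k + 1) ∣ m + 1) :
    ((serialDigit k (m + 1) : ℤ) - (serialDigit k m : ℤ)).natAbs = 1 := by
  rw [serialDigit_eq, serialDigit_eq, Nat.succ_div_of_dvd h1]
  have h2 : ¬ (k + 1) ∣ m / Nat.factorial k + 1 := by
    rw [← Nat.succ_div_of_dvd h1]
    intro h3
    apply h
    rw [Nat.factorial_succ, mul_comm]
    exact Nat.mul_dvd_of_dvd_div h1 h3
  generalize m / Nat.factorial k = q at h2
  rw [Nat.succ_div_of_not_dvd h2]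
  have h5 : q % (k + 1) < k + 1 := Nat.mod_lt _ (Nat.succ_pos k)
  have h6 : (q + 1) % (k + 1) < k + 1 := Nat.mod_lt _ (Nat.succ_pos k)
  have h3 : (q + 1) % (k + 1) = q % (k + 1) + 1 := by
    have h7 : (q % (k + 1) + 1) % (k + 1) = (q + 1) % (k + 1) := Nat.mod_add_mod _ _ _
    rcases Nat.lt_or_ge (q % (k + 1) + 1) (k + 1) with h8 | h8
    · rw [← h7, Nat.mod_eq_of_lt h8]
    · exfalso
      apply h2
      apply Nat.dvd_of_mod_eq_zero
      have : q % (k + 1) + 1 = k + 1 := by omega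
      rw [← h7, this, Nat.mod_self]
  split_ifs <;> omega

theorem digit_ne_iff (k m : ℕ) : serialDigit k m ≠ serialDigit k (m + 1) ↔
    Nat.factorial k ∣ m + 1 ∧ ¬ Nat.factorial (k + 1) ∣ m + 1 := by
  constructor
  · intro h
    exact ⟨by_contra fun h1 => h (digit_same_of_not_dvd k m h1),
      fun h1 => h (digit_same_of_dvd k m h1)⟩
  · rintro ⟨h1, h2⟩ h3
    have := digit_step k m h1 h2
    rw [h3] at this
    simp at this

/-- For every `n ≥ 2` and every `m` with `0 ≤ m < n! − 1`, the vectors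
`(d_1(m),…,d_{n−1}(m))` and `(d_1(m+1),…,d_{n−1}(m+1))` differ in exactly one
coordinate `k`, and at that coordinate `|d_k(m+1) − d_k(m)| = 1`. -/
theorem stmt_4 (n : ℕ) (hn : 2 ≤ n) (m : ℕ) (hm : m < Nat.factorial n - 1) :
    (∃! k : Fin (n - 1),
        serialDigit ((k : ℕ) + 1) m ≠ serialDigit ((k : ℕ) + 1) (m + 1)) ∧
    ∀ k : Fin (n - 1),
      serialDigit ((k : ℕ) + 1) m ≠ serialDigit ((k : ℕ) + 1) (m + 1) →
        ((serialDigit ((k : ℕ) + 1) (m + 1) : ℤ)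
          - (serialDigit ((k : ℕ) + 1) m : ℤ)).natAbs = 1 := by
  constructor
  · have hex : ∃ j, ¬ Nat.factorial j ∣ m + 1 :=
      ⟨n, fun h => by have := Nat.le_of_dvd (Nat.succ_pos m) h; omega⟩
    classical
    have hs := Nat.find_spec hex
    have hmin : ∀ i, i < Nat.find hex → Nat.factorial i ∣ m + 1 :=
      fun i hi => not_not.mp (Nat.find_min hex hi)
    have hle : Nat.find hex ≤ n := Nat.find_min' hex
      (fun h => by have := Nat.le_of_dvd (Nat.succ_pos m) h; omega)
    generalize Nat.find hex = j at hs hmin hle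
    have hj : 2 ≤ j := by
      by_contra hlt
      have : j = 0 ∨ j = 1 := by omega
      rcases this with rfl | rfl <;> simp at hs
    obtain ⟨i, rfl⟩ : ∃ i, j = i + 1 + 1 := ⟨j - 2, by omega⟩
    refine ⟨⟨i, by omega⟩, (digit_ne_iff _ _).2 ⟨hmin _ (by simp), hs⟩, ?_⟩
    intro k hk
    obtain ⟨h1, h2⟩ := (digit_ne_iff _ _).1 hk
    apply Fin.ext
    change (k : ℕ) = i
    by_contra hne
    rcases Nat.lt_or_gt_of_ne hne with hlt | hlt
    · exact h2 (hmin _ (by omega))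
    · exact hs ((Nat.factorial_dvd_factorial (by omega)).trans h1)
  · intro k hk
    obtain ⟨h1, h2⟩ := (digit_ne_iff _ _).1 hk
    exact digit_step _ _ h1 h2
end

section
/- For every natural number m and every k ≥ 2, f_{k−1}(m) = (f_k(m) + d_k(m)) mod 2; that is, the parity flag of column k−1 equals the parity flag of column k flipped exactly when the value d_k(m) is odd. -/
/-- For every natural number `m` and every `k ≥ 2`,
`f_{k−1}(m) = (f_k(m) + d_k(m)) mod 2`: the parity flag of column `k−1` equals the
parity flag of column `k` flipped exactly when the value `d_k(m)` is odd. -/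
theorem stmt_5 (m k : ℕ) (hk : 2 ≤ k) :
    serialFlag (k - 1) m = (serialFlag k m + serialDigit k m) % 2 := by
  obtain ⟨n, rfl⟩ : ∃ n, k = n + 1 := ⟨k - 1, by omega⟩
  have hQ : m / Nat.factorial (n + 1 + 1) = m / Nat.factorial (n + 1) / (n + 1 + 1) := by
    rw [Nat.factorial_succ (n + 1), mul_comm, Nat.div_div_eq_div_mul]
  unfold serialDigit serialFlag
  rw [hQ, Nat.add_sub_cancel]
  generalize m / Nat.factorial (n + 1) = q
  have h1 := Nat.div_add_mod q (n + 1 + 1)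
  have h2 := Nat.mod_lt q (show 0 < n + 1 + 1 by omega)
  generalize q / (n + 1 + 1) = Q at *
  generalize q % (n + 1 + 1) = r at *
  subst h1
  split_ifs with h
  · obtain ⟨t, rfl⟩ : ∃ t, Q = 2 * t := ⟨Q / 2, by omega⟩
    have : (n + 1 + 1) * (2 * t) = 2 * ((n + 1 + 1) * t) := by ring
    omega
  · obtain ⟨t, rfl⟩ : ∃ t, Q = 2 * t + 1 := ⟨Q / 2, by omega⟩
    have : (n + 1 + 1) * (2 * t + 1) = 2 * ((n + 1 + 1) * t) + (n + 2) := by ring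
    omega
end

section
/- For every n ≥ 1, the map sending s ∈ {1,…,n!} to the unique permutation of {1,…,n} whose offset vector equals (d_1(s−1),…,d_{n−1}(s−1)) is a bijection from {1,…,n!} onto the set of permutations of {1,…,n}. -/
/-- The offset (inversion) vector of a permutation `p` of `{1,…,n+1}` (zero-indexed):
`d_i = #{j : j ≤ i, p_j > p_{i+1}}`. -/
def offsetVec {n : ℕ} (p : Equiv.Perm (Fin (n + 1))) : Fin n → ℕ :=
  fun i => (Finset.univ.filter fun j : Fin (n + 1) => j ≤ i.castSucc ∧ p i.succ < p j).card

theorem serialDigit_le (k m : ℕ) : serialDigit k m < k + 1 := by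
  unfold serialDigit
  split_ifs
  · exact Nat.mod_lt _ (Nat.succ_pos k)
  · omega

theorem div_fact_step (k m : ℕ) :
    m / Nat.factorial k
      = (k + 1) * (m / Nat.factorial (k + 1)) + m / Nat.factorial k % (k + 1) := by
  have h : m / Nat.factorial (k + 1) = m / Nat.factorial k / (k + 1) := by
    rw [Nat.div_div_eq_div_mul, Nat.factorial_succ, Nat.mul_comm]
  rw [h]
  exact (Nat.div_add_mod _ _).symm

theorem div_fact_eq (k m m' : ℕ)
    (h : m / Nat.factorial (k + 1) = m' / Nat.factorial (k + 1))
    (hd : serialDigit k m = serialDigit k m') :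
    m / Nat.factorial k = m' / Nat.factorial k := by
  rw [div_fact_step k m, div_fact_step k m', h]
  have h1 : m / Nat.factorial k % (k + 1) < k + 1 := Nat.mod_lt _ (Nat.succ_pos k)
  have h2 : m' / Nat.factorial k % (k + 1) < k + 1 := Nat.mod_lt _ (Nat.succ_pos k)
  unfold serialDigit serialFlag at hd
  rw [h] at hd
  split_ifs at hd <;> omega

theorem serial_inj (n m m' : ℕ) (hm : m < Nat.factorial (n + 1))
    (hm' : m' < Nat.factorial (n + 1))
    (hd : ∀ k : Fin n, serialDigit ((k : ℕ) + 1) m = serialDigit ((k : ℕ) + 1) m') :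
    m = m' := by
  have key : ∀ j, j ≤ n → m / Nat.factorial (n - j + 1) = m' / Nat.factorial (n - j + 1) := by
    intro j
    induction j with
    | zero => intro _; simp [Nat.div_eq_of_lt hm, Nat.div_eq_of_lt hm']
    | succ j ih =>
      intro hj
      apply div_fact_eq
      · have e : n - (j + 1) + 1 + 1 = n - j + 1 := by omega
        rw [e]
        exact ih (by omega)
      · exact hd ⟨n - (j + 1), by omega⟩
  have := key n le_rfl
  simpa using this

theorem offset_lt {n : ℕ} (p : Equiv.Perm (Fin (n + 1))) (i : Fin n) :
    offsetVec p i < (i : ℕ) + 2 := by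
  unfold offsetVec
  have h : (Finset.univ.filter fun j : Fin (n + 1) => j ≤ i.castSucc ∧ p i.succ < p j)
      ⊆ Finset.Iic i.castSucc := by
    intro j hj
    simp at hj ⊢
    exact hj.1
  have := Finset.card_le_card h
  rw [Fin.card_Iic] at this
  simp only [Fin.val_castSucc] at this
  omega

theorem offset_inj {n : ℕ} (p q : Equiv.Perm (Fin (n + 1))) (h : offsetVec p = offsetVec q) :
    p = q := by
  have key : ∀ i : ℕ, ∀ a b : Fin (n + 1), (a : ℕ) ≤ i → (b : ℕ) ≤ i →
      (p a < p b ↔ q a < q b) := by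
    intro i
    induction i with
    | zero =>
      intro a b ha hb
      have : a = b := Fin.ext (by omega)
      simp [this]
    | succ i ih =>
      by_cases hi : i < n
      swap
      · intro a b _ _
        exact ih a b (by omega) (by omega)
      have hc := congrFun h ⟨i, hi⟩
      unfold offsetVec at hc
      have hle : ∀ j : Fin (n + 1), j ≤ (⟨i, hi⟩ : Fin n).castSucc ↔ (j : ℕ) ≤ i := fun j => Iff.rfl
      obtain ⟨c, hcdef⟩ : ∃ c, c = (⟨i, hi⟩ : Fin n).succ := ⟨_, rfl⟩
      have hcv : (c : ℕ) = i + 1 := by rw [hcdef]; rfl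
      rw [← hcdef] at hc
      simp only [hle] at hc
      have hAB : (Finset.univ.filter fun j : Fin (n + 1) => (j : ℕ) ≤ i ∧ p c < p j)
          = (Finset.univ.filter fun j : Fin (n + 1) => (j : ℕ) ≤ i ∧ q c < q j) := by
        by_cases hs : (Finset.univ.filter fun j : Fin (n + 1) => (j : ℕ) ≤ i ∧ p c < p j)
          ⊆ (Finset.univ.filter fun j : Fin (n + 1) => (j : ℕ) ≤ i ∧ q c < q j)
        · exact Finset.eq_of_subset_of_card_le hs hc.ge
        · symm
          refine Finset.eq_of_subset_of_card_le ?_ hc.le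
          obtain ⟨x, hx, hx'⟩ := Finset.not_subset.mp hs
          intro y hy
          simp only [Finset.mem_filter, Finset.mem_univ, true_and, not_and, not_lt] at hx hx' hy ⊢
          refine ⟨hy.1, ?_⟩
          have h1 : q x < q y := lt_of_le_of_lt (hx' hx.1) hy.2
          exact hx.2.trans ((ih x y hx.1 hy.1).mpr h1)
      have hlt : ∀ j : Fin (n + 1), (j : ℕ) ≤ i → (p c < p j ↔ q c < q j) := by
        intro j hj
        have := Finset.ext_iff.mp hAB j
        simpa [hj] using this
      have hgt : ∀ j : Fin (n + 1), (j : ℕ) ≤ i → (p j < p c ↔ q j < q c) := by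
        intro j hj
        have hne : j ≠ c := by rintro rfl; omega
        have hp : p j ≠ p c := p.injective.ne hne
        have hq : q j ≠ q c := q.injective.ne hne
        rw [← not_iff_not, not_lt, not_lt, hp.symm.le_iff_lt, hq.symm.le_iff_lt]
        exact hlt j hj
      intro a b ha hb
      by_cases ha' : (a : ℕ) ≤ i <;> by_cases hb' : (b : ℕ) ≤ i
      · exact ih a b ha' hb'
      · have : b = c := Fin.ext (by omega)
        rw [this]; exact hgt a ha'
      · have : a = c := Fin.ext (by omega)
        rw [this]; exact hlt b hb'
      · have : a = b := Fin.ext (by omega)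
        simp [this]
  have mono : StrictMono (fun x => p (q.symm x)) := by
    intro x y hxy
    refine (key n _ _ (by omega) (by omega)).mpr ?_
    simpa using hxy
  let e : Fin (n + 1) ≃o Fin (n + 1) := StrictMono.orderIsoOfSurjective _ mono
    (p.surjective.comp q.symm.surjective)
  have he : e = OrderIso.refl _ := Subsingleton.elim _ _
  ext x : 1
  have : e (q x) = q x := by rw [he]; rfl
  have h2 : e (q x) = p (q.symm (q x)) := rfl
  rw [h2, Equiv.symm_apply_apply] at this
  exact this

theorem card_codes (n : ℕ) : Fintype.card ((i : Fin n) → Fin ((i : ℕ) + 2)) =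
    Nat.factorial (n + 1) := by
  rw [Fintype.card_pi]
  simp only [Fintype.card_fin]
  rw [Fin.prod_univ_eq_prod_range (fun i => i + 2) n]
  induction n with
  | zero => simp
  | succ n ih => rw [Finset.prod_range_succ, ih, Nat.factorial_succ (n + 1), Nat.mul_comm]

/-- For every `n ≥ 1` (written `n + 1`), the map sending `s ∈ {1,…,n!}` to the unique
permutation of `{1,…,n}` whose offset vector equals `(d_1(s−1),…,d_{n−1}(s−1))` is a
bijection from `{1,…,n!}` onto the set of permutations of `{1,…,n}`. -/
theorem stmt_6 (n : ℕ) :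
    ∃ F : Set.Icc 1 (Nat.factorial (n + 1)) → Equiv.Perm (Fin (n + 1)),
      Function.Bijective F ∧
      ∀ s : Set.Icc 1 (Nat.factorial (n + 1)),
        offsetVec (F s) = (fun k : Fin n => serialDigit ((k : ℕ) + 1) ((s : ℕ) - 1)) ∧
        ∀ p : Equiv.Perm (Fin (n + 1)),
          offsetVec p = (fun k : Fin n => serialDigit ((k : ℕ) + 1) ((s : ℕ) - 1)) →
            p = F s := by
  let O : Equiv.Perm (Fin (n + 1)) → ((i : Fin n) → Fin ((i : ℕ) + 2)) :=
    fun p i => ⟨offsetVec p i, offset_lt p i⟩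
  let D : Set.Icc 1 (Nat.factorial (n + 1)) → ((i : Fin n) → Fin ((i : ℕ) + 2)) :=
    fun s i => ⟨serialDigit ((i : ℕ) + 1) ((s : ℕ) - 1), serialDigit_le _ _⟩
  have hOi : Function.Injective O := by
    intro p q hpq
    apply offset_inj
    funext i
    exact congrArg Fin.val (congrFun hpq i)
  have hDi : Function.Injective D := by
    rintro ⟨s, hs1, hs2⟩ ⟨t, ht1, ht2⟩ hst
    have := serial_inj n (s - 1) (t - 1) (by omega) (by omega)
      (fun k => congrArg Fin.val (congrFun hst k))
    apply Subtype.ext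
    change s = t
    omega
  have hO : Function.Bijective O := by
    rw [Fintype.bijective_iff_injective_and_card]
    refine ⟨hOi, ?_⟩
    rw [card_codes, Fintype.card_perm, Fintype.card_fin]
  have hD : Function.Bijective D := by
    rw [Fintype.bijective_iff_injective_and_card]
    refine ⟨hDi, ?_⟩
    rw [card_codes]
    simp
  let E := Equiv.ofBijective O hO
  have hE : ∀ s, O (E.symm (D s)) = D s := fun s => E.apply_symm_apply (D s)
  have hF : ∀ s : Set.Icc 1 (Nat.factorial (n + 1)), offsetVec (E.symm (D s)) =
      (fun k : Fin n => serialDigit ((k : ℕ) + 1) ((s : ℕ) - 1)) := by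
    intro s
    funext k
    exact congrArg Fin.val (congrFun (hE s) k)
  refine ⟨fun s => E.symm (D s), E.symm.bijective.comp hD, fun s => ⟨hF s, fun p hp => ?_⟩⟩
  exact offset_inj _ _ (hp.trans (hF s).symm)
end

section
/- Let k ≥ 2 and let (c_1,…,c_k) be a composition of n into k parts; set R_i = c_1 + ⋯ + c_i. Then Σ_{i=2}^{k} Σ_{j=0}^{c_i−1} C(R_i − j + i − 2, R_i − j) equals the number of compositions (d_1,…,d_k) of n into k parts such that, at the largest index i ∈ {2,…,k} with d_i ≠ c_i, one has d_i < c_i (i.e., the reversed suffix (d_k,…,d_2) precedes (c_k,…,c_2) lexicographically). In particular, this rank function is a bijection from the compositions of n into k parts onto {0, 1, …, C(n+k−1, n) − 1}. -/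
/-- The rank `Σ_{i=2}^{k} Σ_{j=0}^{c_i−1} C(R_i − j + i − 2, R_i − j)` of a composition
`c` (zero-indexed by `Fin k`, so the one-indexed `i ∈ {2,…,k}` corresponds to indices
`i` with `0 < i`, and `R_i = c_1 + ⋯ + c_i` is the sum of the entries at indices `≤ i`). -/
def compRank {k : ℕ} (c : Fin k → ℕ) : ℕ :=
  ∑ i ∈ Finset.univ.filter (fun i : Fin k => 0 < (i : ℕ)),
    ∑ j ∈ Finset.range (c i),
      Nat.choose ((∑ t ∈ Finset.univ.filter (· ≤ i), c t) - j + (i : ℕ) - 1)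
        ((∑ t ∈ Finset.univ.filter (· ≤ i), c t) - j)

def precC {k : ℕ} (c d : Fin k → ℕ) : Prop :=
  ∃ i : Fin k, 0 < (i : ℕ) ∧ d i < c i ∧ ∀ j : Fin k, i < j → d j = c j

theorem card_adT (k n : ℕ) :
    (Finset.Nat.antidiagonalTuple (k + 1) n).card = Nat.choose (n + k) n := by
  rw [← Finset.piAntidiag_univ_fin_eq_antidiagonalTuple, ← Finset.map_sym_eq_piAntidiag,
    Finset.card_map, Finset.sym_univ, Finset.card_univ, Sym.card_sym_eq_choose]
  simp only [Fintype.card_fin]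
  congr 1
  omega

theorem compRank_succ (m : ℕ) (c : Fin (m + 2) → ℕ) :
    compRank c = compRank (fun i : Fin (m + 1) => c i.castSucc) +
      ∑ j ∈ Finset.range (c (Fin.last _)),
        Nat.choose ((∑ t, c t) - j + m) ((∑ t, c t) - j) := by
  unfold compRank
  rw [Finset.sum_filter (s := Finset.univ) (p := fun i : Fin (m + 2) => 0 < (i : ℕ)),
    Fin.sum_univ_castSucc,
    Finset.sum_filter (s := Finset.univ) (p := fun i : Fin (m + 1) => 0 < (i : ℕ))]
  congr 1
  · refine Finset.sum_congr rfl fun i _ => ?_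
    have h : ∑ t ∈ Finset.univ.filter (· ≤ i.castSucc), c t
        = ∑ t ∈ Finset.univ.filter (· ≤ i), c t.castSucc := by
      rw [Finset.sum_filter, Fin.sum_univ_castSucc, Finset.sum_filter]
      simp [Fin.last_le_iff, Fin.castSucc_ne_last]
    simp only [h, Fin.val_castSucc]
  · have h : Finset.univ.filter (· ≤ Fin.last (m + 1)) = Finset.univ := by
      ext t; simp [Fin.le_last]
    rw [h]
    simp

open Classical in
theorem fiber_card (m N j : ℕ) (hj : j ≤ N) (Q : (Fin (m + 1) → ℕ) → Prop) :
    ((Finset.Nat.antidiagonalTuple (m + 2) N).filter fun d =>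
      d (Fin.last _) = j ∧ Q (fun i => d i.castSucc)).card =
    ((Finset.Nat.antidiagonalTuple (m + 1) (N - j)).filter Q).card := by
  refine Finset.card_nbij' (fun d i => d i.castSucc)
    (fun e => Fin.snoc (α := fun _ => ℕ) e j) ?_ ?_ ?_ ?_
  · intro d hd
    simp only [Finset.coe_filter, Set.mem_ofPred_eq, Finset.Nat.mem_antidiagonalTuple,
      Fin.sum_univ_castSucc (n := m + 1)] at hd ⊢
    exact ⟨by omega, hd.2.2⟩
  · intro e he
    simp only [Finset.coe_filter, Set.mem_ofPred_eq, Finset.Nat.mem_antidiagonalTuple,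
      Fin.sum_univ_castSucc (n := m + 1), Fin.snoc_castSucc, Fin.snoc_last] at he ⊢
    exact ⟨by omega, trivial, he.2⟩
  · intro d hd
    simp only [Finset.coe_filter, Set.mem_ofPred_eq] at hd
    funext i
    refine Fin.lastCases ?_ (fun i => ?_) i
    · simp [hd.2.1]
    · simp
  · intro e he
    funext i
    simp

theorem precC_succ (m : ℕ) (c d : Fin (m + 2) → ℕ) :
    precC c d ↔ d (Fin.last _) < c (Fin.last _) ∨ (d (Fin.last _) = c (Fin.last _) ∧
      precC (fun i : Fin (m + 1) => c i.castSucc) (fun i => d i.castSucc)) := by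
  constructor
  · rintro ⟨i, hi, h1, h2⟩
    induction i using Fin.lastCases with
    | last => exact Or.inl h1
    | cast i =>
      refine Or.inr ⟨h2 _ (Fin.castSucc_lt_last i), i, hi, h1, fun j hj => h2 _ ?_⟩
      exact Fin.castSucc_lt_castSucc_iff.2 hj
  · rintro (h | ⟨h, i, hi, h1, h2⟩)
    · exact ⟨Fin.last _, by simp, h, fun j hj => absurd hj (Fin.le_last j).not_gt⟩
    · refine ⟨i.castSucc, hi, h1, fun j => ?_⟩
      refine Fin.lastCases (fun _ => h) (fun j hj => ?_) j
      exact h2 j (Fin.castSucc_lt_castSucc_iff.1 hj)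

open Classical in
theorem compRank_eq (m : ℕ) : ∀ c : Fin (m + 1) → ℕ, compRank c =
    ((Finset.Nat.antidiagonalTuple (m + 1) (∑ i, c i)).filter (precC c)).card := by
  induction m with
  | zero =>
    intro c
    have h : ∀ d, ¬ precC c d := by
      rintro d ⟨i, hi, -⟩
      omega
    simp [h, compRank]
  | succ m ih =>
    intro c
    have hN := Fin.sum_univ_castSucc c
    rw [compRank_succ, ih]
    rw [Finset.card_eq_sum_card_fiberwise (s := Finset.filter (precC c) _)
        (f := fun d : Fin (m + 2) → ℕ => d (Fin.last (m + 1)))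
        (t := Finset.range (c (Fin.last (m + 1)) + 1)), Finset.sum_range_succ, add_comm]
    · congr 1
      · refine Finset.sum_congr rfl fun j hj => ?_
        rw [Finset.mem_range] at hj
        have h := fiber_card m (∑ i, c i) j (by omega) (fun _ => True)
        rw [Finset.filter_true, card_adT] at h
        rw [← h, Finset.filter_filter]
        congr 1
        ext d
        simp only [Finset.mem_filter]
        refine and_congr_right fun _ => ?_
        rw [precC_succ]
        constructor
        · rintro ⟨h, -⟩
          exact ⟨Or.inl (by omega), h⟩
        · rintro ⟨-, h⟩
          exact ⟨h, trivial⟩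
      · have h := fiber_card m (∑ i, c i) (c (Fin.last _)) (by omega)
          (precC (fun i : Fin (m + 1) => c i.castSucc))
        rw [show ∑ i, c i - c (Fin.last _) = ∑ i : Fin (m + 1), c i.castSucc by omega] at h
        rw [← h, Finset.filter_filter]
        congr 1
        refine Finset.filter_congr fun d _ => ?_
        rw [precC_succ]
        constructor
        · rintro ⟨h, h'⟩
          exact ⟨Or.inr ⟨h, h'⟩, h⟩
        · rintro ⟨h | h, h'⟩
          · omega
          · exact h
    · intro d hd
      simp only [Finset.coe_filter, Set.mem_ofPred_eq, precC_succ] at hd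
      simp only [Finset.coe_range, Set.mem_Iio]
      rcases hd.2 with h | h <;> omega

theorem precC_irrefl {k : ℕ} (c : Fin k → ℕ) : ¬ precC c c := by
  rintro ⟨i, -, h, -⟩
  exact lt_irrefl _ h

theorem precC_trans {k : ℕ} {a b c : Fin k → ℕ} (h1 : precC b a) (h2 : precC c b) :
    precC c a := by
  obtain ⟨i, hi, h, H⟩ := h1
  obtain ⟨j, hj, h', H'⟩ := h2
  rcases lt_trichotomy i j with hij | rfl | hij
  · exact ⟨j, hj, by rw [H j hij]; exact h', fun t ht => (H t (hij.trans ht)).trans (H' t ht)⟩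
  · exact ⟨i, hi, h.trans h', fun t ht => (H t ht).trans (H' t ht)⟩
  · exact ⟨i, hi, by rw [← H' i hij]; exact h, fun t ht => (H t ht).trans (H' t (hij.trans ht))⟩

theorem precC_total (m : ℕ) : ∀ c d : Fin (m + 1) → ℕ, ∑ i, c i = ∑ i, d i →
    precC c d ∨ c = d ∨ precC d c := by
  induction m with
  | zero =>
    intro c d h
    right; left
    funext i
    have : i = 0 := by omega
    subst this
    simpa using h
  | succ m ih =>
    intro c d h
    rw [Fin.sum_univ_castSucc c, Fin.sum_univ_castSucc d] at h
    rw [precC_succ, precC_succ]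
    rcases lt_trichotomy (c (Fin.last _)) (d (Fin.last _)) with hl | hl | hl
    · exact Or.inr (Or.inr (Or.inl hl))
    · rcases ih (fun i => c i.castSucc) (fun i => d i.castSucc) (by omega) with h1 | h1 | h1
      · exact Or.inl (Or.inr ⟨hl.symm, h1⟩)
      · right; left
        funext i
        exact Fin.lastCases hl (fun i => congrFun h1 i) i
      · exact Or.inr (Or.inr (Or.inr ⟨hl, h1⟩))
    · exact Or.inl (Or.inl hl)

theorem compRank_lt (m : ℕ) (c d : Fin (m + 1) → ℕ) (h : ∑ i, c i = ∑ i, d i)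
    (hp : precC c d) : compRank d < compRank c := by
  classical
  rw [compRank_eq, compRank_eq, h]
  refine Finset.card_lt_card ((Finset.ssubset_iff_of_subset ?_).2 ⟨d, ?_, ?_⟩)
  · intro e he
    rw [Finset.mem_filter] at he ⊢
    exact ⟨he.1, precC_trans he.2 hp⟩
  · rw [Finset.mem_filter, Finset.Nat.mem_antidiagonalTuple]
    exact ⟨rfl, hp⟩
  · rw [Finset.mem_filter]
    exact fun h => precC_irrefl d h.2

open Classical in
/-- Let `k ≥ 2` and let `c = (c_1,…,c_k)` be a composition of `n` into `k` parts.
Then `compRank c` equals the number of compositions `d` of `n` into `k` parts such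
that at the largest index `i ∈ {2,…,k}` with `d_i ≠ c_i` one has `d_i < c_i`
(the reversed suffix of `d` precedes that of `c` lexicographically). In particular,
the rank function is a bijection from the compositions of `n` into `k` parts onto
`{0, 1, …, C(n+k−1, n) − 1}`. -/
theorem stmt_9 (n k : ℕ) (hk : 2 ≤ k) (c : Fin k → ℕ) (hc : ∑ i, c i = n) :
    compRank c =
      ((Finset.Nat.antidiagonalTuple k n).filter fun d : Fin k → ℕ =>
          ∃ i : Fin k, 0 < (i : ℕ) ∧ d i < c i ∧ ∀ j : Fin k, i < j → d j = c j).card ∧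
    Set.BijOn (fun c : Fin k → ℕ => compRank c)
      {c : Fin k → ℕ | ∑ i, c i = n}
      (Set.Iio (Nat.choose (n + k - 1) n)) := by
  obtain ⟨m, rfl⟩ : ∃ m, k = m + 1 := ⟨k - 1, by omega⟩
  refine ⟨?_, ?_⟩
  · subst hc
    rw [compRank_eq]
    congr 1
    exact Finset.filter_congr (fun d _ => Iff.rfl)
  have hset : {c : Fin (m + 1) → ℕ | ∑ i, c i = n} =
      (Finset.Nat.antidiagonalTuple (m + 1) n : Set (Fin (m + 1) → ℕ)) := by
    ext d
    simp [Finset.Nat.mem_antidiagonalTuple]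
  have hmaps : Set.MapsTo (fun c : Fin (m + 1) → ℕ => compRank c)
      (Finset.Nat.antidiagonalTuple (m + 1) n : Set (Fin (m + 1) → ℕ))
      (Finset.range (Nat.choose (n + m) n) : Set ℕ) := by
    intro d hd
    have hd' : ∑ i, d i = n := Finset.Nat.mem_antidiagonalTuple.1 (Finset.mem_coe.1 hd)
    simp only [Finset.coe_range, Set.mem_Iio]
    rw [compRank_eq, hd', ← card_adT]
    refine Finset.card_lt_card ((Finset.ssubset_iff_of_subset (Finset.filter_subset _ _)).2
      ⟨d, hd, ?_⟩)
    rw [Finset.mem_filter]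
    exact fun h => precC_irrefl d h.2
  have hinj : Set.InjOn (fun c : Fin (m + 1) → ℕ => compRank c)
      (Finset.Nat.antidiagonalTuple (m + 1) n : Set (Fin (m + 1) → ℕ)) := by
    intro a ha b hb hab
    have ha' : ∑ i, a i = n := Finset.Nat.mem_antidiagonalTuple.1 (Finset.mem_coe.1 ha)
    have hb' : ∑ i, b i = n := Finset.Nat.mem_antidiagonalTuple.1 (Finset.mem_coe.1 hb)
    simp only at hab
    rcases precC_total m a b (by omega) with h | h | h
    · have := compRank_lt m a b (by omega) h
      omega
    · exact h
    · have := compRank_lt m b a (by omega) h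
      omega
  have hsurj := Finset.surjOn_of_injOn_of_card_le _ hmaps hinj
    (by rw [card_adT, Finset.card_range])
  rw [hset, show n + (m + 1) - 1 = n + m by omega, ← Finset.coe_range]
  exact ⟨hmaps, hinj, hsurj⟩
end

section
/- For every n ≥ 0, every m with 0 ≤ m < 2^n, and every i with 0 ≤ i < n, the i-th binary digit of m satisfies ⌊m/2^i⌋ mod 2 = (Σ_{j=i}^{n−1} p_j(m)) mod 2; that is, each bit of m is recovered as the XOR of the components p_i(m), p_{i+1}(m), …, p_{n−1}(m). -/
/-- `p_k(m) = ⌊((m + 2^k) mod 2^{k+2}) / 2^{k+1}⌋`. -/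
def pbit (k m : ℕ) : ℕ := (m + 2 ^ k) % 2 ^ (k + 2) / 2 ^ (k + 1)

theorem pbit_step (k m : ℕ) :
    m / 2 ^ k % 2 = (pbit k m + m / 2 ^ (k + 1) % 2) % 2 := by
  have h1 : pbit k m = (m / 2 ^ k + 1) / 2 % 2 := by
    unfold pbit
    rw [show 2 ^ (k + 2) = 2 ^ (k + 1) * 2 by ring, Nat.mod_mul_right_div_self,
      pow_succ, ← Nat.div_div_eq_div_mul, Nat.add_div_right _ (by positivity)]
  rw [h1, pow_succ, ← Nat.div_div_eq_div_mul]
  omega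

theorem pbit_sum (n m i : ℕ) (hm : m < 2 ^ n) (hi : i ≤ n) :
    m / 2 ^ i % 2 = (∑ j ∈ Finset.Ico i n, pbit j m) % 2 := by
  induction hi using Nat.decreasingInduction with
  | self => simp [Nat.div_eq_of_lt hm]
  | of_succ k hk ih =>
    rw [Finset.sum_eq_sum_Ico_succ_bot hk, pbit_step, ih]
    omega

/-- For every `n ≥ 0`, every `m` with `0 ≤ m < 2^n`, and every `i` with `0 ≤ i < n`,
the `i`-th binary digit of `m` satisfies
`⌊m/2^i⌋ mod 2 = (Σ_{j=i}^{n−1} p_j(m)) mod 2`. -/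
theorem stmt_13 (n m i : ℕ) (hm : m < 2 ^ n) (hi : i < n) :
    m / 2 ^ i % 2 = (∑ j ∈ Finset.Ico i n, pbit j m) % 2 := 
  pbit_sum n m i hm hi.le
end

section
/- For every n ≥ 1 and every m with 0 ≤ m < 2^n − 1, the vectors (p_0(m),…,p_{n−1}(m)) and (p_0(m+1),…,p_{n−1}(m+1)) differ in exactly one coordinate. -/
theorem pbit_ne_iff (k m : ℕ) :
    pbit k m ≠ pbit k (m + 1) ↔ ∃ c, m + 1 = 2 ^ k * (2 * c + 1) := by
  have h4 : 2 ^ (k + 2) = 2 ^ (k + 1) * 2 := by ring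
  have e : m + 1 + 2 ^ k = (m + 2 ^ k) + 1 := by ring
  have hp : 0 < 2 ^ k := by positivity
  unfold pbit
  rw [h4, Nat.mod_mul_right_div_self, Nat.mod_mul_right_div_self, e, Nat.succ_div]
  have key : 2 ^ (k + 1) ∣ m + 2 ^ k + 1 ↔ ∃ c, m + 1 = 2 ^ k * (2 * c + 1) := by
    constructor
    · rintro ⟨d, hd⟩
      rcases d with _ | d
      · omega
      · refine ⟨d, ?_⟩
        have : 2 ^ (k + 1) * (d + 1) = 2 ^ k * (2 * d + 1) + 2 ^ k := by ring
        omega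
    · rintro ⟨c, hc⟩
      refine ⟨c + 1, ?_⟩
      have : 2 ^ (k + 1) * (c + 1) = 2 ^ k * (2 * c + 1) + 2 ^ k := by ring
      omega
  rw [← key]
  split_ifs with h
  · simp only [h, iff_true]; omega
  · simp [h]

theorem two_pow_odd_not_lt (j k c d : ℕ) (h : 2 ^ j * (2 * c + 1) = 2 ^ k * (2 * d + 1)) :
    ¬ j < k := by
  intro hlt
  obtain ⟨t, rfl⟩ := Nat.exists_eq_add_of_lt hlt
  have h2 : 2 ^ j * (2 * c + 1) = 2 ^ j * (2 * (2 ^ t * (2 * d + 1))) := by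
    rw [h]; ring
  have := Nat.eq_of_mul_eq_mul_left (by positivity) h2
  omega

/-- For every `n ≥ 1` and every `m` with `0 ≤ m < 2^n − 1`, the vectors
`(p_0(m),…,p_{n−1}(m))` and `(p_0(m+1),…,p_{n−1}(m+1))` differ in exactly one
coordinate. -/
theorem stmt_14 (n : ℕ) (hn : 1 ≤ n) (m : ℕ) (hm : m < 2 ^ n - 1) :
    ∃! k : Fin n, pbit (k : ℕ) m ≠ pbit (k : ℕ) (m + 1) := by
  obtain ⟨k, o, ⟨c, rfl⟩, h⟩ := Nat.exists_eq_two_pow_mul_odd (n := m + 1) (by omega)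
  have hk : k < n := by
    have h1 : 2 ^ k ≤ m + 1 := by rw [h]; exact Nat.le_mul_of_pos_right _ (by omega)
    exact (Nat.pow_lt_pow_iff_right (a := 2) (by norm_num)).1 (by omega)
  refine ⟨⟨k, hk⟩, (pbit_ne_iff k m).2 ⟨c, h⟩, ?_⟩
  intro j hj
  obtain ⟨d, hd⟩ := (pbit_ne_iff j m).1 hj
  have a1 := two_pow_odd_not_lt _ _ _ _ (h.symm.trans hd)
  have a2 := two_pow_odd_not_lt _ _ _ _ (hd.symm.trans h)
  apply Fin.ext
  show (j : ℕ) = k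
  omega
end

section
/- Define N : ℕ × ℕ → ℕ by N(0, m) = 1 and N(r+1, m) = m·N(r, m) + N(r, m+1). Then for every r ≥ 0, N(r, 1) = B_{r+1}, the number of partitions of an (r+1)-element set. -/
/-- `N(0, m) = 1` and `N(r+1, m) = m·N(r, m) + N(r, m+1)`. -/
def bellRec : ℕ → ℕ → ℕ
  | 0, _ => 1
  | r + 1, m => m * bellRec r m + bellRec r (m + 1)

namespace BellAux
open Classical

/-- The map classifying an extension of `s` to `Option α`. -/
def f {α : Type} (s : Setoid α) (x : Option (Quotient s)) : Option α → Option (Quotient s)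
  | none => x
  | some a => some (Quotient.mk s a)

/-- Extension of a setoid by one point. -/
def extend {α : Type} (p : Σ s : Setoid α, Option (Quotient s)) : Setoid (Option α) :=
  Setoid.ker (f p.1 p.2)

theorem extend_some {α : Type} (s : Setoid α) (x) (a b : α) :
    (extend ⟨s, x⟩) (some a) (some b) ↔ s a b := by
  show some (Quotient.mk s a) = some (Quotient.mk s b) ↔ _
  rw [Option.some_inj]
  exact Quotient.eq

theorem extend_none {α : Type} (s : Setoid α) (x) (a : α) :
    (extend ⟨s, x⟩) none (some a) ↔ x = some (Quotient.mk s a) := Iff.rfl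

theorem extend_bij {α : Type} : Function.Bijective (extend (α := α)) := by
  constructor
  · rintro ⟨s, x⟩ ⟨t, y⟩ h
    have hst : s = t := by
      ext a b
      rw [← extend_some s x, h, extend_some]
    subst hst
    have hx : ∀ a, x = some (Quotient.mk s a) ↔ y = some (Quotient.mk s a) := by
      intro a
      rw [← extend_none, h, extend_none]
    congr 1
    rcases x with _ | x
    · rcases y with _ | y
      · rfl
      · induction y using Quotient.inductionOn with
        | h a => exact (hx a).2 rfl
    · induction x using Quotient.inductionOn with
      | h a => exact ((hx a).1 rfl).symm
  · intro t
    let s : Setoid α := Setoid.comap some t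
    have hs : ∀ a b, s a b ↔ t (some a) (some b) := fun a b => Iff.rfl
    have key : ∃ x : Option (Quotient s), ∀ a, x = some (Quotient.mk s a) ↔ t none (some a) := by
      by_cases h : ∃ a, t none (some a)
      · obtain ⟨a, ha⟩ := h
        refine ⟨some (Quotient.mk s a), fun b => ?_⟩
        rw [Option.some_inj]
        refine (Quotient.eq (r := s)).trans ((hs a b).trans ?_)
        exact ⟨fun h => t.trans' ha h, fun h => t.trans' (t.symm' ha) h⟩
      · push Not at h
        exact ⟨none, fun b => ⟨fun h => by simp at h, fun hb => (h b hb).elim⟩⟩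
    obtain ⟨x, hx⟩ := key
    refine ⟨⟨s, x⟩, ?_⟩
    ext a b
    rcases a with _ | a <;> rcases b with _ | b
    · exact ⟨fun _ => t.refl' _, fun _ => Setoid.refl' _ _⟩
    · exact hx b
    · rw [Setoid.comm' (extend _), Setoid.comm' t]
      exact hx a
    · rw [extend_some, hs]

theorem card_extend_none {α : Type} [Finite α] (s : Setoid α) :
    Nat.card (Quotient (extend ⟨s, none⟩)) = Nat.card (Quotient s) + 1 := by
  rw [← Finite.card_option]
  refine Nat.card_congr (Setoid.quotientKerEquivOfSurjective (f s none) ?_)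
  rintro (_ | q)
  · exact ⟨none, rfl⟩
  · induction q using Quotient.inductionOn with
    | h a => exact ⟨some a, rfl⟩

theorem card_extend_some {α : Type} [Finite α] (s : Setoid α) (q : Quotient s) :
    Nat.card (Quotient (extend ⟨s, some q⟩)) = Nat.card (Quotient s) := by
  have e : Set.range (f s (some q)) = Set.range (some : Quotient s → _) := by
    ext y
    constructor
    · rintro ⟨_ | a, rfl⟩
      · exact ⟨q, rfl⟩
      · exact ⟨_, rfl⟩
    · rintro ⟨p, rfl⟩
      induction p using Quotient.inductionOn with
      | h a => exact ⟨some a, rfl⟩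
  refine (Nat.card_congr (Setoid.quotientKerEquivRange (f s (some q)))).trans ?_
  rw [e]
  exact Nat.card_congr (Equiv.ofInjective _ (Option.some_injective _)).symm

instance finite_setoid {α : Type} [Finite α] : Finite (Setoid α) := by
  refine Finite.of_injective (fun s : Setoid α => (fun a b => s a b : α → α → Prop)) ?_
  intro s t h
  ext a b
  exact iff_of_eq (congrFun (congrFun h a) b)

theorem card_setoid_le {α β : Type} [Finite α] [Finite β] (e : α ≃ β) :
    Nat.card (Setoid β) ≤ Nat.card (Setoid α) := by
  refine Nat.card_le_card_of_injective (Setoid.comap e) fun s t h => ?_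
  ext a b
  have := congrArg (fun u : Setoid α => u (e.symm a) (e.symm b)) h
  simpa [Setoid.comap_rel] using this

attribute [local instance] Fintype.ofFinite

theorem main (r : ℕ) : ∀ (α β : Type) [Finite α] [Finite β], Nat.card β = Nat.card α + r →
    ∑ s : Setoid α, bellRec r (Nat.card (Quotient s)) = Nat.card (Setoid β) := by
  induction r with
  | zero =>
    intro α β _ _ h
    have e : α ≃ β := (Finite.card_eq.1 (by omega)).some
    simp only [bellRec, Finset.sum_const, Finset.card_univ, smul_eq_mul, mul_one,
      ← Nat.card_eq_fintype_card]
    exact le_antisymm (card_setoid_le e.symm) (card_setoid_le e)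
  | succ r ih =>
    intro α β _ _ h
    rw [← ih (Option α) β (by rw [Finite.card_option]; omega),
      ← (Equiv.ofBijective _ (extend_bij (α := α))).sum_comp]
    have hs := Fintype.sum_sigma (fun p : Σ s : Setoid α, Option (Quotient s) =>
        bellRec r (Nat.card (Quotient (extend p))))
    refine Eq.trans ?_ (Eq.trans hs.symm ?_)
    · refine Finset.sum_congr rfl fun s _ => ?_
      have ho := Fintype.sum_option (fun x : Option (Quotient s) =>
        bellRec r (Nat.card (Quotient (extend ⟨s, x⟩))))
      simp only [card_extend_none, card_extend_some, Finset.sum_const, Finset.card_univ,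
        ← Nat.card_eq_fintype_card, smul_eq_mul] at ho
      rw [bellRec, add_comm, ← ho]
    · exact Finset.sum_congr (by ext; simp) fun _ _ => rfl

end BellAux

/-- For every `r ≥ 0`, `N(r, 1) = B_{r+1}`, the number of partitions of an
`(r+1)`-element set, i.e. the number of equivalence relations on a set with
`r+1` elements. -/
theorem stmt_16 (r : ℕ) : bellRec r 1 = Nat.card (Setoid (Fin (r + 1))) := by
  letI : Fintype (Setoid Unit) := Fintype.ofFinite _
  have h := BellAux.main r Unit (Fin (r + 1)) (by simp; omega)
  rw [← h]
  have hu : ∀ s : Setoid Unit, s = ⊤ := by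
    intro s
    ext a b
    exact ⟨fun _ => trivial, fun _ => s.refl' _⟩
  have hc : ∀ s : Setoid Unit, Nat.card (Quotient s) = 1 := by
    intro s
    rw [Nat.card_eq_one_iff_unique]
    exact ⟨inferInstance, ⟨Quotient.mk s ()⟩⟩
  rw [Finset.sum_congr rfl (fun s _ => by rw [hc s])]
  rw [Finset.sum_const, Finset.card_univ, Fintype.card_eq_one_iff.2 ⟨⊤, hu⟩, one_smul]
end

section
/- Fix n ≥ 1 and define integers D_{u,v} for 0 ≤ u ≤ n−1 and 0 ≤ v ≤ n−1−u by D_{u,0} = B_{n−u} and D_{u,v} = D_{u,v−1} − v·D_{u+1,v−1} for v ≥ 1. Then every entry satisfies D_{u,v} ≥ 1, and the rightmost entry of each row equals one: D_{u, n−1−u} = 1 for all 0 ≤ u ≤ n−1. -/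
/-- `B_k`, the Bell number: the number of partitions of a `k`-element set, i.e. the
number of equivalence relations on a set with `k` elements. -/
noncomputable def bell (k : ℕ) : ℕ := Nat.card (Setoid (Fin k))

/-- The matrix `D` of the Serial Partition of an `n`-Set Method:
`D_{u,0} = B_{n−u}` and `D_{u,v} = D_{u,v−1} − v·D_{u+1,v−1}` for `v ≥ 1`. -/
noncomputable def Dmat (n : ℕ) : ℕ → ℕ → ℤ
  | u, 0 => (bell (n - u) : ℤ)
  | u, v + 1 => Dmat n u v - ((v : ℤ) + 1) * Dmat n (u + 1) v

/-- Number of ways to extend a partition with `j` blocks by `m` further elements. -/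
def extCount : ℕ → ℕ → ℕ
  | 0, _ => 1
  | m + 1, j => j * extCount m j + extCount m (j + 1)

lemma extCount_pos (m j : ℕ) : 1 ≤ extCount m (j + 1) := by
  induction m generalizing j with
  | zero => simp [extCount]
  | succ m ih => have := ih (j + 1); simp only [extCount]; omega

instance setoidFinite (α : Type) [Finite α] : Finite (Setoid α) :=
  Finite.of_injective (fun s : Setoid α => s.r) (by
    intro s t h
    ext a b
    exact iff_of_eq (congrFun (congrFun h a) b))

/-- Classifying map of the extended partition. -/
def phi {α : Type} (s : Setoid α) (o : Option (Quotient s)) : Option α → Option (Quotient s)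
  | none => o
  | some a => some (Quotient.mk s a)

/-- Extend a setoid by one further element. -/
def extS {α : Type} (p : Σ s : Setoid α, Option (Quotient s)) : Setoid (Option α) :=
  Setoid.ker (phi p.1 p.2)

lemma extS_bij {α : Type} : Function.Bijective (extS (α := α)) := by
  constructor
  · rintro ⟨s, o⟩ ⟨s', o'⟩ h
    have h1 : ∀ x y, phi s o x = phi s o y ↔ phi s' o' x = phi s' o' y := fun x y =>
      Setoid.ext_iff.1 h x y
    have hs : s = s' := by
      ext a b
      have := h1 (some a) (some b)
      simp only [phi, Option.some.injEq] at this
      rw [Quotient.eq, Quotient.eq] at this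
      exact this
    subst hs
    have ho : o = o' := by
      ext q
      induction q using Quotient.inductionOn with
      | h a => exact h1 none (some a)
    rw [ho]
  · intro t
    by_cases h : ∃ a, t (some a) none
    · obtain ⟨a, ha⟩ := h
      refine ⟨⟨t.comap some, some (Quotient.mk _ a)⟩, ?_⟩
      ext x y
      change phi _ _ x = phi _ _ y ↔ _
      rcases x with _ | x <;> rcases y with _ | y <;>
        simp only [phi, Option.some.injEq, Quotient.eq, Setoid.comap_rel]
      · simp [t.refl]
      · exact ⟨fun h => t.trans (t.symm ha) h, fun h => t.trans ha h⟩
      · exact ⟨fun h => t.trans h ha, fun h => t.trans h (t.symm ha)⟩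
    · push Not at h
      refine ⟨⟨t.comap some, none⟩, ?_⟩
      ext x y
      change phi _ _ x = phi _ _ y ↔ _
      rcases x with _ | x <;> rcases y with _ | y <;>
        simp only [phi, Option.some.injEq, Quotient.eq, Setoid.comap_rel]
      · simp [t.refl]
      · simpa using fun h' => h y (t.symm h')
      · simpa using h x

lemma card_extS_none {α : Type} [Finite α] (s : Setoid α) :
    Nat.card (Quotient (extS ⟨s, none⟩)) = Nat.card (Quotient s) + 1 := by
  rw [← Finite.card_option]
  refine Nat.card_congr (Setoid.quotientKerEquivOfSurjective (phi s none) ?_)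
  rintro (_ | q)
  · exact ⟨none, rfl⟩
  · induction q using Quotient.inductionOn with
    | h a => exact ⟨some a, rfl⟩

lemma card_extS_some {α : Type} [Finite α] (s : Setoid α) (q : Quotient s) :
    Nat.card (Quotient (extS ⟨s, some q⟩)) = Nat.card (Quotient s) := by
  refine (Nat.card_congr (Setoid.quotientKerEquivRange (phi s (some q)))).trans ?_
  have : Set.range (phi s (some q)) = Set.range (some : Quotient s → _) := by
    ext x
    constructor
    · rintro ⟨_ | a, rfl⟩
      · exact ⟨q, rfl⟩
      · exact ⟨_, rfl⟩
    · rintro ⟨r, rfl⟩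
      induction r using Quotient.inductionOn with
      | h a => exact ⟨some a, rfl⟩
  rw [this]
  exact (Nat.card_congr (Equiv.ofInjective _ (Option.some_injective _))).symm

open Classical in
lemma sum_extCount (m : ℕ) : ∀ (α β : Type) [Finite α] [Finite β] [Fintype (Setoid α)],
    Nat.card β = Nat.card α + m →
    ∑ s : Setoid α, extCount m (Nat.card (Quotient s)) = Nat.card (Setoid β) := by
  induction m with
  | zero =>
    intro α β _ _ _ h
    have e : β ≃ α := (Finite.card_eq.1 h).some
    simp only [extCount, Finset.sum_const, smul_eq_mul, mul_one, Finset.card_univ]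
    rw [← Nat.card_eq_fintype_card]
    refine Nat.card_congr ⟨fun s => s.comap e, fun s => s.comap e.symm, ?_, ?_⟩
    · intro s; ext a b; simp [Setoid.comap_rel]
    · intro s; ext a b; simp [Setoid.comap_rel]
  | succ m ih =>
    intro α β _ _ _ h
    letI : Fintype (Setoid (Option α)) := Fintype.ofFinite _
    letI : ∀ s : Setoid α, Fintype (Quotient s) := fun s => Fintype.ofFinite _
    rw [← ih (Option α) β (by rw [Finite.card_option]; omega)]
    rw [← extS_bij.sum_comp (fun t => extCount m (Nat.card (Quotient t))), Fintype.sum_sigma]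
    refine Finset.sum_congr rfl fun s _ => ?_
    rw [Fintype.sum_option, card_extS_none]
    simp only [card_extS_some, Finset.sum_const, smul_eq_mul, Finset.card_univ, extCount]
    rw [← Nat.card_eq_fintype_card]
    omega

lemma bell_eq (k : ℕ) : bell (k + 1) = extCount k 1 := by
  classical
  letI : Fintype (Setoid (Fin 1)) := Fintype.ofFinite _
  rw [bell, ← sum_extCount k (Fin 1) (Fin (k + 1)) (by simp; omega)]
  have hq : ∀ s : Setoid (Fin 1), Nat.card (Quotient s) = 1 := fun s => by
    haveI : Subsingleton (Quotient s) := Quot.Subsingleton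
    haveI : Nonempty (Quotient s) := ⟨Quotient.mk s 0⟩
    exact Nat.card_eq_one_iff_unique.2 ⟨inferInstance, inferInstance⟩
  have hc : Fintype.card (Setoid (Fin 1)) = 1 := by
    refine Fintype.card_eq_one_iff.2 ⟨⊤, fun s => ?_⟩
    ext a b
    rw [Subsingleton.elim a b]
    simp [s.refl]
  simp only [hq, Finset.sum_const, Finset.card_univ, hc, one_smul]

lemma Dmat_eq (n v : ℕ) : ∀ u m : ℕ, n = u + v + m + 1 →
    Dmat n u v = extCount m (v + 1) := by
  induction v with
  | zero =>
    intro u m h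
    rw [Dmat, show n - u = m + 1 by omega, bell_eq]
  | succ v ih =>
    intro u m h
    rw [Dmat, ih u (m + 1) (by omega), ih (u + 1) m (by omega)]
    simp only [extCount]
    push_cast
    ring

/-- Fix `n ≥ 1`. Every entry of the matrix `D` (with `0 ≤ u ≤ n−1`,
`0 ≤ v ≤ n−1−u`) satisfies `D_{u,v} ≥ 1`, and the rightmost entry of each row
equals one: `D_{u, n−1−u} = 1` for all `0 ≤ u ≤ n−1`. -/
theorem stmt_17 (n : ℕ) (hn : 1 ≤ n) :
    (∀ u v : ℕ, u ≤ n - 1 → v ≤ n - 1 - u → 1 ≤ Dmat n u v) ∧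
    (∀ u : ℕ, u ≤ n - 1 → Dmat n u (n - 1 - u) = 1) := by
  constructor
  · intro u v hu hv
    rw [Dmat_eq n v u (n - 1 - u - v) (by omega)]
    exact_mod_cast extCount_pos _ _
  · intro u hu
    rw [Dmat_eq n _ u 0 (by omega)]
    simp [extCount]
end
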